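/- arXiv:1101.3971 — 2 statements merged into one kernel-verified Lean document; each statement's English description precedes it below -/
import Mathlib

section
/- Every class preserving automorphism of the dihedral group of order 16 is inner. -/
namespace DihedralGroup

variable {n : ℕ}

theorem monoidHom_ext {H : Type*} [Group H] {f g : DihedralGroup n →* H}
    (hr : f (r 1) = g (r 1)) (hs : f (sr 0) = g (sr 0)) : f = g := by
  have h (i : ZMod n) : f (r i) = g (r i) := by
    obtain ⟨k, rfl⟩ := ZMod.intCast_surjective i
    have hk : (r (k : ZMod n)) = r 1 ^ k := by simp
    rw [hk, map_zpow, map_zpow, hr]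
  ext x
  cases x with
  | r i => exact h i
  | sr i =>
    have hi : sr i = sr 0 * r i := by simp
    rw [hi, map_mul, map_mul, hs, h]

theorem eq_or_eq_neg_of_isConj_r {i : ZMod n} {x : DihedralGroup n} (h : IsConj (r i) x) :
    x = r i ∨ x = r (-i) := by
  obtain ⟨c | c, rfl⟩ := isConj_iff.mp h
  · left; simp
  · right; simp

theorem exists_eq_sr_add_self_of_isConj {x : DihedralGroup n} (h : IsConj (sr 0) x) :
    ∃ k : ZMod n, x = sr (k + k) := by
  obtain ⟨c | c, rfl⟩ := isConj_iff.mp h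
  · exact ⟨-c, by simp [sub_eq_add_neg]⟩
  · exact ⟨c, by simp⟩

/-- Class preserving endomorphisms of a dihedral group (finite or infinite) are inner. -/
theorem exists_eq_conj_of_forall_isConj (f : DihedralGroup n →* DihedralGroup n)
    (hf : ∀ x, IsConj x (f x)) : ∃ g, ∀ x, f x = g⁻¹ * x * g := by
  suffices h : ∃ g : DihedralGroup n, f (r 1) = g⁻¹ * r 1 * g ∧ f (sr 0) = g⁻¹ * sr 0 * g by
    obtain ⟨g, hr, hs⟩ := h
    have hfg : f = (MulAut.conj g⁻¹).toMonoidHom :=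
      monoidHom_ext (by simpa using hr) (by simpa using hs)
    exact ⟨g, fun x => by simp [hfg]⟩
  obtain ⟨k, hk⟩ := exists_eq_sr_add_self_of_isConj (hf (sr 0))
  rcases eq_or_eq_neg_of_isConj_r (hf (r 1)) with h | h
  · exact ⟨r k, by simp [h], by simp [hk]⟩
  · exact ⟨sr k, by simp [h], by simp [hk]⟩

end DihedralGroup

/-- Every class preserving automorphism of the dihedral group of order 16 is inner. -/
theorem class_preserving_inner_dihedral16 :
    ∀ α : DihedralGroup 8 ≃* DihedralGroup 8,
      (∀ x : DihedralGroup 8, IsConj x (α x)) →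
      ∃ g : DihedralGroup 8, ∀ x : DihedralGroup 8, α x = g⁻¹ * x * g :=
  fun α hα => DihedralGroup.exists_eq_conj_of_forall_isConj α.toMonoidHom hα
end

section
/- Every class preserving automorphism of the group G = Q₁₆ × C₂, the direct product of the generalized quaternion group of order 16 with the cyclic group of order 2 (a group of order 32), is inner. -/
namespace QuaternionGroup

/-- Homomorphisms out of a generalized quaternion group agreeing on the generators are equal. -/
theorem monoidHom_ext {n : ℕ} [NeZero n] {M : Type*} [Monoid M] {f g : QuaternionGroup n →* M}
    (ha : f (a 1) = g (a 1)) (hx : f (xa 0) = g (xa 0)) : f = g := by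
  have h (i : ZMod (2 * n)) : f (a i) = g (a i) := by
    rw [← ZMod.natCast_zmod_val i, ← a_one_pow, map_pow, map_pow, ha]
  ext x
  rcases x with i | i
  · exact h i
  · rw [← zero_add i, ← xa_mul_a, map_mul, map_mul, hx, h]

/-- Conjugating the two generators independently amounts to a simultaneous conjugation. -/
theorem exists_simultaneous_conj {n : ℕ} (c d : QuaternionGroup n) :
    ∃ g, c * a 1 * c⁻¹ = g⁻¹ * a 1 * g ∧ d * xa 0 * d⁻¹ = g⁻¹ * xa 0 * g := by
  have inv_a (i : ZMod (2 * n)) : (a i)⁻¹ = a (-i) := rfl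
  have inv_xa (i : ZMod (2 * n)) : (xa i)⁻¹ = xa ((n : ZMod (2 * n)) + i) := rfl
  have h : (2 * n : ZMod (2 * n)) = 0 := by norm_cast; simp
  rcases c with i | i <;> rcases d with j | j
  · refine ⟨a (-j), ?_⟩
    simp [inv_a]
  · refine ⟨a j, ?_⟩
    simp [inv_a, inv_xa]
  · refine ⟨xa (-j), ?_⟩
    simp [inv_a, inv_xa]
    grind
  · refine ⟨xa j, ?_⟩
    simp [inv_xa]
    grind

end QuaternionGroup

/-- Every class preserving automorphism of `Q₁₆ × C₂` (of order 32) is inner. -/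
theorem class_preserving_inner_quaternion16_prod_C2 :
    ∀ α : (QuaternionGroup 4 × Multiplicative (ZMod 2)) ≃*
          (QuaternionGroup 4 × Multiplicative (ZMod 2)),
      (∀ x : QuaternionGroup 4 × Multiplicative (ZMod 2), IsConj x (α x)) →
      ∃ g : QuaternionGroup 4 × Multiplicative (ZMod 2),
        ∀ x : QuaternionGroup 4 × Multiplicative (ZMod 2), α x = g⁻¹ * x * g := by
  intro α hα
  obtain ⟨c, hc⟩ := isConj_iff.1 (hα (QuaternionGroup.a 1, 1))
  obtain ⟨d, hd⟩ := isConj_iff.1 (hα (QuaternionGroup.xa 0, 1))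
  obtain ⟨g, hg₁, hg₂⟩ := QuaternionGroup.exists_simultaneous_conj c.1 d.1
  have hz (z : Multiplicative (ZMod 2)) : α (1, z) = (1, z) := by
    obtain ⟨e, he⟩ := isConj_iff.1 (hα (1, z))
    rw [← he]
    ext <;> simp
  have hq : α.toMonoidHom.comp (MonoidHom.inl _ _) =
      (MonoidHom.inl _ _).comp (MulAut.conj g⁻¹).toMonoidHom := by
    apply QuaternionGroup.monoidHom_ext
    · simp [← hc, ← hg₁, Prod.ext_iff]
    · simp [← hd, ← hg₂, Prod.ext_iff]
  refine ⟨(g, 1), fun ⟨q, z⟩ => ?_⟩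
  have hqz : α (q, 1) = (g⁻¹ * q * g, 1) := by simpa using DFunLike.congr_fun hq q
  calc
    α (q, z) = α ((q, 1) * (1, z)) := by simp
    _ = (g, 1)⁻¹ * (q, z) * (g, 1) := by rw [map_mul, hqz, hz]; simp
end
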